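/- Let S : ℤ → 𝕊² satisfy −1 < S_n·S_{n+1} < 1 and γ_n ∈ (−π,π) for all n ∈ ℤ, and Σ_{ℓ≤n} |γ_ℓ| < ∞ for every n, where θ_n, γ_n are the angle coordinates of S; set Γ(n) = Σ_{ℓ≤n} γ_ℓ and α_n = tan(θ_n/2) e^{−iΓ(n)}. Then for any pair of functions F, G from {Re α_n, Im α_n : n ∈ ℤ}, all but finitely many summands in the Poisson bracket {F,G}(S) vanish, and the brackets are given by: {Re α_n, Im α_m} equals: −((1+|α_m|²)/2)·Im(α_n)·Im(α_{m−1}−α_{m+1}) if n ≥ m+2; −((1+|α_m|²)/2)·[Im(α_n)·Im(α_{m−1}−α_{m+1}) + (1+|α_n|²)/2] if n = m+1; ((1+|α_n|²)/2)·[1 − Re(α_n·conj(α_{n−1}))] if n = m; −((1+|α_n|²)/2)·[Re(α_m)·Re(α_{n−1}−α_{n+1}) + (1+|α_m|²)/2] if n = m−1; −((1+|α_n|²)/2)·Re(α_m)·Re(α_{n−1}−α_{n+1}) if n ≤ m−2. For n ≥ m+1: {Re α_n, Re α_m} = −((1+|α_m|²)/2)·Im(α_n)·Re(α_{m−1}−α_{m+1})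 and {Im α_n, Im α_m} = ((1+|α_m|²)/2)·Re(α_n)·Im(α_{m−1}−α_{m+1}); all remaining brackets among these functions are determined by antisymmetry ({F,G} = −{G,F}, so in particular {Re α_n, Re α_n} = {Im α_n, Im α_n} = 0). -/

import Mathlib

open scoped BigOperators
noncomputable section

/-- Euclidean 3-space. -/
abbrev R3 := EuclideanSpace ℝ (Fin 3)

/-- The dot product on ℝ³. -/
def vdot (a b : R3) : ℝ := inner ℝ a b

/-- The cross product on ℝ³. -/
def vcross (a b : R3) : R3 :=
  (WithLp.equiv 2 (Fin 3 → ℝ)).symm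
    (crossProduct ((WithLp.equiv 2 (Fin 3 → ℝ)) a) ((WithLp.equiv 2 (Fin 3 → ℝ)) b))

/-- The gradient ∇_k F(S) in the variable S_k of the degree-zero homogeneous extension of `F`
(obtained by replacing S_k by S_k/|S_k|), evaluated at `S`. -/
def gradk (F : (ℤ → R3) → ℝ) (S : ℤ → R3) (k : ℤ) : R3 :=
  gradient (fun v : R3 => F (Function.update S k (‖v‖⁻¹ • v))) (S k)

/-- The summand `S_k · (∇_k F × ∇_k G)` of the Poisson bracket. -/
def pbTerm (F G : (ℤ → R3) → ℝ) (S : ℤ → R3) (k : ℤ) : ℝ :=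
  vdot (S k) (vcross (gradk F S k) (gradk G S k))

/-- The Poisson bracket {F,G}(S) = −Σ_{k∈ℤ} S_k · (∇_k F(S) × ∇_k G(S)). -/
def pb (F G : (ℤ → R3) → ℝ) (S : ℤ → R3) : ℝ :=
  -∑' k : ℤ, pbTerm F G S k

/-- The coordinate θ_n, as a function of the spin configuration:
θ_n = arccos(S_n·S_{n+1}) ∈ (0,π), so that cos θ_n = S_n·S_{n+1}. -/
def thetaF (n : ℤ) : (ℤ → R3) → ℝ := fun S => Real.arccos (vdot (S n) (S (n+1)))

/-- The coordinate γ_n ∈ (−π,π], as a function of the spin configuration: the argument of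
(S_{n−1}×S_n)·(S_n×S_{n+1}) + i S_{n−1}·(S_n×S_{n+1}), so that
sin θ_{n−1} sin θ_n e^{iγ_n} = (S_{n−1}×S_n)·(S_n×S_{n+1}) + i S_{n−1}·(S_n×S_{n+1}). -/
def gammaF (n : ℤ) : (ℤ → R3) → ℝ := fun S =>
  Complex.arg (((vdot (vcross (S (n-1)) (S n)) (vcross (S n) (S (n+1))) : ℝ) : ℂ)
    + ((vdot (S (n-1)) (vcross (S n) (S (n+1))) : ℝ) : ℂ) * Complex.I)

/-- Cotangent. -/
def cot (x : ℝ) : ℝ := Real.cos x / Real.sin x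

/-- Γ(n) = Σ_{ℓ≤n} γ_ℓ, as a function of the spin configuration. -/
def GammaF (n : ℤ) : (ℤ → R3) → ℝ := fun S => ∑' ℓ : {ℓ : ℤ // ℓ ≤ n}, gammaF ℓ.val S

/-- The discrete Hasimoto coordinate α_n = tan(θ_n/2) e^{−iΓ(n)}, as a function of the
spin configuration. -/
def alphaF (n : ℤ) : (ℤ → R3) → ℂ := fun S =>
  ((Real.tan (thetaF n S / 2) : ℝ) : ℂ) * Complex.exp (-Complex.I * ((GammaF n S : ℝ) : ℂ))

/-- Re α_n as a function of the spin configuration. -/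
def reA (n : ℤ) : (ℤ → R3) → ℝ := fun S => (alphaF n S).re

/-- Im α_n as a function of the spin configuration. -/
def imA (n : ℤ) : (ℤ → R3) → ℝ := fun S => (alphaF n S).im

lemma vdot_eq (a b : R3) : vdot a b = a 0 * b 0 + a 1 * b 1 + a 2 * b 2 := by
  simp [vdot, Fin.sum_univ_three, PiLp.inner_apply]; ring

lemma vcross_zero (a b : R3) : vcross a b 0 = a 1 * b 2 - a 2 * b 1 := by
  simp [vcross, crossProduct]

lemma vcross_one (a b : R3) : vcross a b 1 = a 2 * b 0 - a 0 * b 2 := by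
  simp [vcross, crossProduct]

lemma vcross_two (a b : R3) : vcross a b 2 = a 0 * b 1 - a 1 * b 0 := by
  simp [vcross, crossProduct]

lemma smul_vcross_sub_smul (a b c : R3) :
    vdot (vcross a b) (vcross b c) • vcross b c
        - vdot a (vcross b c) • (vdot b c • b - vdot b b • c)
      = (vdot b b * vdot c c - vdot b c ^ 2) • vcross a b := by
  ext i
  fin_cases i <;> simp [vdot_eq, vcross_zero, vcross_one, vcross_two] <;> ring

lemma smul_vcross_sub_smul_right (a b c : R3) :
    vdot (vcross a b) (vcross b c) • vcross a b
        - vdot a (vcross b c) • (vdot a b • b - vdot b b • a)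
      = (vdot a a * vdot b b - vdot a b ^ 2) • vcross b c := by
  ext i
  fin_cases i <;> simp [vdot_eq, vcross_zero, vcross_one, vcross_two] <;> ring

lemma smul_vcross_sub_smul_mid (a b c : R3) :
    vdot b b • (vdot (vcross a b) (vcross b c) • vcross c a
        - vdot a (vcross b c) • (vdot b c • a + vdot a b • c - (2 * vdot a c) • b))
      = -(vdot a b * (vdot b b * vdot c c - vdot b c ^ 2)) • vcross a b
        - (vdot b c * (vdot a a * vdot b b - vdot a b ^ 2)) • vcross b c
        - (vdot (vcross a b) (vcross b c) * vdot a (vcross b c)) • b := by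
  ext i
  fin_cases i <;> simp [vdot_eq, vcross_zero, vcross_one, vcross_two] <;> ring

lemma vdot_vcross_sq_add_sq (a b c : R3) :
    vdot (vcross a b) (vcross b c) ^ 2 + vdot b b * vdot a (vcross b c) ^ 2
      = (vdot a a * vdot b b - vdot a b ^ 2) * (vdot b b * vdot c c - vdot b c ^ 2) := by
  simp only [vdot_eq, vcross_zero, vcross_one, vcross_two]; ring

/-! ### Gradients -/

lemma inner_eq_coords (a b : R3) : inner ℝ a b = a 0 * b 0 + a 1 * b 1 + a 2 * b 2 :=
  vdot_eq a b

lemma hasGradientAt_vdot (w x : R3) : HasGradientAt (fun v => vdot w v) w x := by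
  rw [hasGradientAt_iff_hasFDerivAt]
  exact (InnerProductSpace.toDual ℝ R3 w).hasFDerivAt

lemma hasGradientAt_vdot_right (w x : R3) : HasGradientAt (fun v => vdot v w) w x := by
  have : (fun v => vdot v w) = fun v => vdot w v := by
    funext v; simp only [vdot_eq]; ring
  rw [this]; exact hasGradientAt_vdot w x

lemma HasGradientAt.congr_gradient {f : R3 → ℝ} {X Y x : R3} (h : HasGradientAt f X x)
    (e : X = Y) : HasGradientAt f Y x := e ▸ h

lemma HasGradientAt.add' {f g : R3 → ℝ} {X Y x : R3} (hf : HasGradientAt f X x)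
    (hg : HasGradientAt g Y x) : HasGradientAt (fun v => f v + g v) (X + Y) x := by
  rw [hasGradientAt_iff_hasFDerivAt] at *
  rw [map_add]; exact hf.add hg

lemma HasGradientAt.mul' {f g : R3 → ℝ} {X Y x : R3} (hf : HasGradientAt f X x)
    (hg : HasGradientAt g Y x) :
    HasGradientAt (fun v => f v * g v) (f x • Y + g x • X) x := by
  rw [hasGradientAt_iff_hasFDerivAt] at *
  rw [map_add, map_smul, map_smul]; exact hf.mul hg

lemma HasGradientAt.comp_deriv {f : R3 → ℝ} {h : ℝ → ℝ} {h' : ℝ} {X x : R3}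
    (hf : HasGradientAt f X x) (hh : HasDerivAt h h' (f x)) :
    HasGradientAt (fun v => h (f v)) (h' • X) x := by
  rw [hasGradientAt_iff_hasFDerivAt] at *
  rw [map_smul]; exact hh.comp_hasFDerivAt x hf

lemma hasGradientAt_vdot_self (x : R3) :
    HasGradientAt (fun v => vdot v v) ((2 : ℝ) • x) x := by
  rw [hasGradientAt_iff_hasFDerivAt]
  have h := (hasFDerivAt_id (𝕜 := ℝ) x).inner ℝ (hasFDerivAt_id x)
  refine h.congr_fderiv ?_
  ext v
  simp [real_inner_comm, two_mul]

lemma HasGradientAt.arg {P Q : R3 → ℝ} {X Y x : R3} (hP : HasGradientAt P X x)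
    (hQ : HasGradientAt Q Y x)
    (hz : ((P x : ℝ) : ℂ) + ((Q x : ℝ) : ℂ) * Complex.I ∈ Complex.slitPlane) :
    HasGradientAt (fun v => Complex.arg (((P v : ℝ) : ℂ) + ((Q v : ℝ) : ℂ) * Complex.I))
      ((P x ^ 2 + Q x ^ 2)⁻¹ • (P x • Y - Q x • X)) x := by
  rw [hasGradientAt_iff_hasFDerivAt] at *
  have h1 : HasFDerivAt (fun v => ((P v : ℝ) : ℂ)) _ x :=
    (Complex.ofRealCLM.hasFDerivAt (x := P x)).comp x hP
  have h2 : HasFDerivAt (fun v => ((Q v : ℝ) : ℂ)) _ x :=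
    (Complex.ofRealCLM.hasFDerivAt (x := Q x)).comp x hQ
  have h3 := h1.add (h2.mul_const Complex.I)
  have h4 := (Complex.hasStrictFDerivAt_log_real hz).hasFDerivAt.comp x h3
  have h5 := (Complex.imCLM.hasFDerivAt (x := Complex.log _)).comp x h4
  have h6 : HasFDerivAt
      (fun v => Complex.arg (((P v : ℝ) : ℂ) + ((Q v : ℝ) : ℂ) * Complex.I)) _ x :=
    h5.congr_of_eventuallyEq (Filter.Eventually.of_forall fun v => by
      simp [Complex.log_im])
  refine h6.congr_fderiv ?_
  refine ContinuousLinearMap.ext fun v => ?_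
  simp [Complex.normSq_apply]
  simp only [inner_eq_coords]
  field_simp
  ring

lemma HasGradientAt.comp_normalize {G : R3 → ℝ} {X b : R3} (hb : vdot b b = 1)
    (hG : HasGradientAt G X b) :
    HasGradientAt (fun v => G (‖v‖⁻¹ • v)) (X - vdot b X • b) b := by
  have hn : ‖b‖ = 1 := by
    have : ‖b‖ ^ 2 = 1 := by rw [← real_inner_self_eq_norm_sq]; exact hb
    nlinarith [norm_nonneg b]
  have hN : (fun v : R3 => ‖v‖⁻¹) = fun v => (√(vdot v v))⁻¹ := by
    funext v; rw [vdot, real_inner_self_eq_norm_sq, Real.sqrt_sq (norm_nonneg v)]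
  have h1 : HasGradientAt (fun v : R3 => ‖v‖⁻¹) (-b) b := by
    rw [hN]
    have hs : HasDerivAt (fun y : ℝ => (√y)⁻¹) (-(1 / 2)) (vdot b b) := by
      rw [hb]
      have := (Real.hasDerivAt_sqrt (x := 1) one_ne_zero).inv (by simp)
      exact this.congr_deriv (by norm_num)
    convert (hasGradientAt_vdot_self b).comp_deriv hs using 1
    rw [smul_smul]; norm_num
  rw [hasGradientAt_iff_hasFDerivAt] at *
  have h2 := h1.smul (hasFDerivAt_id b)
  have h3 : HasFDerivAt G (InnerProductSpace.toDual ℝ R3 X) (‖b‖⁻¹ • b) := by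
    rw [hn, inv_one, one_smul]; exact hG
  have h4 := HasFDerivAt.comp (f := fun v : R3 => ‖v‖⁻¹ • v) b h3 h2
  refine h4.congr_fderiv ?_
  refine ContinuousLinearMap.ext fun v => ?_
  simp [hn]
  simp only [vdot_eq, inner_eq_coords, PiLp.smul_apply, smul_eq_mul]
  ring

lemma pbTerm_eq_of_hasGradientAt {F G : (ℤ → R3) → ℝ} {S : ℤ → R3} {k : ℤ} {X Y : R3}
    (hk : vdot (S k) (S k) = 1)
    (hF : HasGradientAt (fun v => F (Function.update S k v)) X (S k))
    (hG : HasGradientAt (fun v => G (Function.update S k v)) Y (S k)) :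
    pbTerm F G S k = vdot (S k) (vcross X Y) := by
  rw [pbTerm, gradk, gradk, (hF.comp_normalize hk).gradient, (hG.comp_normalize hk).gradient]
  simp only [vdot_eq, vcross_zero, vcross_one, vcross_two, PiLp.sub_apply, PiLp.smul_apply,
    smul_eq_mul]
  ring

/-! ### Half-angle tangents and turning angles -/

lemma tan_half_arccos_pos {c : ℝ} (h : c ∈ Set.Ioo (-1 : ℝ) 1) :
    0 < Real.tan (Real.arccos c / 2) := by
  have h0 : 0 < Real.arccos c := Real.arccos_pos.2 h.2
  have h1 : Real.arccos c < Real.pi := Real.arccos_lt_pi.2 h.1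
  exact Real.tan_pos_of_pos_of_lt_pi_div_two (by linarith) (by linarith)

lemma cos_half_arccos_sq {c : ℝ} (h : c ∈ Set.Ioo (-1 : ℝ) 1) :
    Real.cos (Real.arccos c / 2) ^ 2 = (1 + c) / 2 := by
  rw [Real.cos_sq, mul_div_cancel₀ _ two_ne_zero, Real.cos_arccos h.1.le h.2.le]; ring

lemma tan_half_arccos_sq {c : ℝ} (h : c ∈ Set.Ioo (-1 : ℝ) 1) :
    Real.tan (Real.arccos c / 2) ^ 2 * (1 + c) = 1 - c := by
  have h1 := cos_half_arccos_sq h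
  have h2 := Real.sin_sq_add_cos_sq (Real.arccos c / 2)
  have h3 : (1 + c) ≠ 0 := by linarith [h.1]
  rw [Real.tan_eq_sin_div_cos, div_pow, h1, show Real.sin (Real.arccos c / 2) ^ 2 = (1 - c) / 2 by
    linarith]
  field_simp

lemma hasDerivAt_tan_half_arccos {c : ℝ} (h : c ∈ Set.Ioo (-1 : ℝ) 1) :
    HasDerivAt (fun x => Real.tan (Real.arccos x / 2))
      (-((1 + c) ^ 2 * Real.tan (Real.arccos c / 2))⁻¹) c := by
  have hcos := cos_half_arccos_sq h
  have hc : (0 : ℝ) < 1 + c := by linarith [h.1]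
  have hne : Real.cos (Real.arccos c / 2) ≠ 0 := by
    intro h0; rw [h0] at hcos; norm_num at hcos; linarith
  have ht := tan_half_arccos_pos h
  have hs : √(1 - c ^ 2) = (1 + c) * Real.tan (Real.arccos c / 2) := by
    rw [Real.sqrt_eq_iff_mul_self_eq (by nlinarith [h.1, h.2]) (by positivity)]
    linear_combination -(1 + c) * tan_half_arccos_sq h
  have h1 := (Real.hasDerivAt_arccos h.1.ne' h.2.ne).div_const 2
  have h2 := (Real.hasDerivAt_tan hne).comp c h1
  refine h2.congr_deriv ?_
  rw [hs, hcos]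
  field_simp

/-- The turning angle at `b` of the spherical polygonal path `a, b, c`. -/
def turnAngle (a b c : R3) : ℝ :=
  Complex.arg (((vdot (vcross a b) (vcross b c) : ℝ) : ℂ)
    + ((vdot a (vcross b c) : ℝ) : ℂ) * Complex.I)

lemma sq_add_sq_of_unit {a b c : R3} (ha : vdot a a = 1) (hb : vdot b b = 1) (hc : vdot c c = 1) :
    vdot (vcross a b) (vcross b c) ^ 2 + vdot a (vcross b c) ^ 2
      = (1 - vdot a b ^ 2) * (1 - vdot b c ^ 2) := by
  have := vdot_vcross_sq_add_sq a b c
  rw [ha, hb, hc] at this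
  linarith

lemma one_sub_sq_pos {x : ℝ} (h : x ∈ Set.Ioo (-1 : ℝ) 1) : 0 < 1 - x ^ 2 := by
  nlinarith [h.1, h.2]

section TurnAngle

variable {a b c : R3} (ha : vdot a a = 1) (hb : vdot b b = 1) (hc : vdot c c = 1)
  (hab : vdot a b ∈ Set.Ioo (-1 : ℝ) 1) (hbc : vdot b c ∈ Set.Ioo (-1 : ℝ) 1)
  (hγ : turnAngle a b c ∈ Set.Ioo (-Real.pi) Real.pi)

include ha hb hc

lemma norm_turn :
    ‖((vdot (vcross a b) (vcross b c) : ℝ) : ℂ) + ((vdot a (vcross b c) : ℝ) : ℂ) * Complex.I‖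
      = √((1 - vdot a b ^ 2) * (1 - vdot b c ^ 2)) := by
  rw [← sq_add_sq_of_unit ha hb hc, Complex.norm_add_mul_I]

lemma vdot_vcross_vcross_eq_cos :
    vdot (vcross a b) (vcross b c)
      = √((1 - vdot a b ^ 2) * (1 - vdot b c ^ 2)) * Real.cos (turnAngle a b c) := by
  rw [← norm_turn ha hb hc, turnAngle, Complex.norm_mul_cos_arg]; simp

lemma vdot_vcross_eq_sin :
    vdot a (vcross b c)
      = √((1 - vdot a b ^ 2) * (1 - vdot b c ^ 2)) * Real.sin (turnAngle a b c) := by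
  rw [← norm_turn ha hb hc, turnAngle, Complex.norm_mul_sin_arg]; simp

include hab hbc hγ

lemma turn_mem_slitPlane :
    ((vdot (vcross a b) (vcross b c) : ℝ) : ℂ) + ((vdot a (vcross b c) : ℝ) : ℂ) * Complex.I
      ∈ Complex.slitPlane := by
  rw [Complex.mem_slitPlane_iff_arg]
  refine ⟨hγ.2.ne, ?_⟩
  rw [← norm_ne_zero_iff, norm_turn ha hb hc]
  exact (Real.sqrt_pos.2 (mul_pos (one_sub_sq_pos hab) (one_sub_sq_pos hbc))).ne'

lemma hasGradientAt_turnAngle_left :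
    HasGradientAt (fun v => turnAngle v b c) ((1 - vdot a b ^ 2)⁻¹ • vcross a b) a := by
  have hP : HasGradientAt (fun v => vdot (vcross v b) (vcross b c))
      (vdot b c • b - vdot b b • c) a := by
    have : (fun v => vdot (vcross v b) (vcross b c))
        = fun v => vdot v (vdot b c • b - vdot b b • c) := by
      funext v
      simp only [vdot_eq, vcross_zero, vcross_one, vcross_two, PiLp.sub_apply, PiLp.smul_apply,
        smul_eq_mul]
      ring
    rw [this]; exact hasGradientAt_vdot_right _ _
  have hQ := hasGradientAt_vdot_right (vcross b c) a
  have h := hP.arg hQ (turn_mem_slitPlane ha hb hc hab hbc hγ)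
  have h1 := one_sub_sq_pos hab
  have h2 := one_sub_sq_pos hbc
  rw [smul_vcross_sub_smul, sq_add_sq_of_unit ha hb hc, hb, hc, smul_smul] at h
  refine h.congr_gradient ?_
  congr 1
  field_simp

lemma hasGradientAt_turnAngle_right :
    HasGradientAt (fun v => turnAngle a b v) ((1 - vdot b c ^ 2)⁻¹ • vcross b c) c := by
  have hP : HasGradientAt (fun v => vdot (vcross a b) (vcross b v))
      (vdot a b • b - vdot b b • a) c := by
    have : (fun v => vdot (vcross a b) (vcross b v))
        = fun v => vdot v (vdot a b • b - vdot b b • a) := by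
      funext v
      simp only [vdot_eq, vcross_zero, vcross_one, vcross_two, PiLp.sub_apply, PiLp.smul_apply,
        smul_eq_mul]
      ring
    rw [this]; exact hasGradientAt_vdot_right _ _
  have hQ : HasGradientAt (fun v => vdot a (vcross b v)) (vcross a b) c := by
    have : (fun v => vdot a (vcross b v)) = fun v => vdot v (vcross a b) := by
      funext v
      simp only [vdot_eq, vcross_zero, vcross_one, vcross_two]
      ring
    rw [this]; exact hasGradientAt_vdot_right _ _
  have h := hP.arg hQ (turn_mem_slitPlane ha hb hc hab hbc hγ)
  have h1 := one_sub_sq_pos hab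
  have h2 := one_sub_sq_pos hbc
  rw [smul_vcross_sub_smul_right, sq_add_sq_of_unit ha hb hc, ha, hb, smul_smul] at h
  refine h.congr_gradient ?_
  congr 1
  field_simp

lemma hasGradientAt_turnAngle_mid :
    HasGradientAt (fun v => turnAngle a v c)
      (-(vdot a b * (1 - vdot a b ^ 2)⁻¹) • vcross a b
        - (vdot b c * (1 - vdot b c ^ 2)⁻¹) • vcross b c
        - (vdot (vcross a b) (vcross b c) * vdot a (vcross b c)
            * ((1 - vdot a b ^ 2) * (1 - vdot b c ^ 2))⁻¹) • b) b := by
  have hP : HasGradientAt (fun v => vdot (vcross a v) (vcross v c))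
      (vdot b c • a + vdot a b • c - (2 * vdot a c) • b) b := by
    have : (fun v => vdot (vcross a v) (vcross v c))
        = fun v => vdot a v * vdot v c + -vdot a c * vdot v v := by
      funext v
      simp only [vdot_eq, vcross_zero, vcross_one, vcross_two]
      ring
    rw [this]
    have h1 := ((hasGradientAt_vdot a b).mul' (hasGradientAt_vdot_right c b)).add'
      ((hasGradientAt_vdot_self b).comp_deriv
        ((hasDerivAt_id (vdot b b)).const_mul (-vdot a c)))
    refine h1.congr_gradient ?_
    module
  have hQ : HasGradientAt (fun v => vdot a (vcross v c)) (vcross c a) b := by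
    have : (fun v => vdot a (vcross v c)) = fun v => vdot v (vcross c a) := by
      funext v
      simp only [vdot_eq, vcross_zero, vcross_one, vcross_two]
      ring
    rw [this]; exact hasGradientAt_vdot_right _ _
  have h := hP.arg hQ (turn_mem_slitPlane ha hb hc hab hbc hγ)
  have h1 := one_sub_sq_pos hab
  have h2 := one_sub_sq_pos hbc
  have h3 := smul_vcross_sub_smul_mid a b c
  rw [hb, one_smul] at h3
  rw [h3, sq_add_sq_of_unit ha hb hc, ha, hc] at h
  refine h.congr_gradient ?_
  simp only [smul_sub, smul_smul]
  refine congrArg₂ _ (congrArg₂ _ ?_ ?_) ?_ <;> refine congrArg (· • _) ?_ <;> field_simp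

end TurnAngle

/-! ### The spin chain -/

/-- The cosine of the angle between the `n`-th and the `(n+1)`-st spin. -/
def spinCos (S : ℤ → R3) (n : ℤ) : ℝ := vdot (S n) (S (n + 1))

/-- The modulus `tan (θ_n / 2)` of `α_n`. -/
def tanF (n : ℤ) : (ℤ → R3) → ℝ := fun S => Real.tan (thetaF n S / 2)

lemma gammaF_eq_turnAngle (n : ℤ) (S : ℤ → R3) :
    gammaF n S = turnAngle (S (n - 1)) (S n) (S (n + 1)) := rfl

lemma gammaF_update_of_ne {S : ℤ → R3} {k n : ℤ} (h₁ : n ≠ k - 1) (h₂ : n ≠ k) (h₃ : n ≠ k + 1)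
    (v : R3) : gammaF n (Function.update S k v) = gammaF n S := by
  simp only [gammaF_eq_turnAngle]
  rw [Function.update_of_ne (by omega), Function.update_of_ne h₂, Function.update_of_ne (by omega)]

lemma tanF_update_of_ne {S : ℤ → R3} {k n : ℤ} (h₁ : k ≠ n) (h₂ : k ≠ n + 1)
    (v : R3) : tanF n (Function.update S k v) = tanF n S := by
  simp only [tanF, thetaF]
  rw [Function.update_of_ne h₁.symm, Function.update_of_ne h₂.symm]

/-- Summability of the turning angles to the left of every site. -/
def LeftSummable (S : ℤ → R3) : Prop :=
  ∀ n : ℤ, Summable (fun ℓ : {ℓ : ℤ // ℓ ≤ n} => gammaF ℓ.val S)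

lemma LeftSummable.update {S : ℤ → R3} (h : LeftSummable S) (k : ℤ) (v : R3) :
    LeftSummable (Function.update S k v) := by
  intro n
  refine (h n).congr_cofinite ?_
  have hfin : ({k - 1, k, k + 1} : Set ℤ).Finite := by simp
  have hfin' : {ℓ : {ℓ : ℤ // ℓ ≤ n} | ℓ.val ∈ ({k - 1, k, k + 1} : Set ℤ)}.Finite :=
    hfin.preimage Subtype.val_injective.injOn
  filter_upwards [hfin'.compl_mem_cofinite] with ℓ hℓ
  simp only [Set.mem_compl_iff, Set.mem_ofPred_eq, Set.mem_insert_iff, Set.mem_singleton_iff,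
    not_or] at hℓ
  exact (gammaF_update_of_ne hℓ.1 hℓ.2.1 hℓ.2.2 v).symm

lemma LeftSummable.GammaF_eq {S : ℤ → R3} (h : LeftSummable S) (n : ℤ) :
    GammaF n S = GammaF (n - 1) S + gammaF n S := by
  have hset : Set.Iic n = Set.Iic (n - 1) ∪ {n} := by
    ext x; simp only [Set.mem_Iic, Set.mem_union, Set.mem_singleton_iff]; omega
  have hd : Disjoint (Set.Iic (n - 1)) {n} := by simp
  have h1 : GammaF n S = ∑' ℓ : Set.Iic n, gammaF ℓ S := rfl
  have h2 : GammaF (n - 1) S = ∑' ℓ : Set.Iic (n - 1), gammaF ℓ S := rfl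
  rw [h1, h2, hset, Summable.tsum_union_disjoint (f := fun ℓ => gammaF ℓ S) hd (h (n - 1))
    (Summable.of_finite), tsum_singleton n (fun ℓ => gammaF ℓ S)]

lemma GammaF_update_of_lt {S : ℤ → R3} {k n : ℤ} (h : n < k - 1) (v : R3) :
    GammaF n (Function.update S k v) = GammaF n S := by
  refine tsum_congr fun ℓ => ?_
  have := ℓ.2
  exact gammaF_update_of_ne (by omega) (by omega) (by omega) v

/-- The hypotheses on a spin configuration under which the coordinates `α_n` are smooth. -/
structure RegularChain (S : ℤ → R3) : Prop where
  unit : ∀ n, vdot (S n) (S n) = 1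
  dot_mem : ∀ n, spinCos S n ∈ Set.Ioo (-1 : ℝ) 1
  gamma_mem : ∀ n, gammaF n S ∈ Set.Ioo (-Real.pi) Real.pi
  summable : LeftSummable S

/-- The gradient of `tan (θ_n / 2)` in the `k`-th spin. -/
def gradTan (S : ℤ → R3) (n k : ℤ) : R3 :=
  gradient (fun v => tanF n (Function.update S k v)) (S k)

/-- The gradient of `Γ(n)` in the `k`-th spin. -/
def gradGamma (S : ℤ → R3) (n k : ℤ) : R3 :=
  gradient (fun v => GammaF n (Function.update S k v)) (S k)

/-- The derivative of `tan (θ / 2)` with respect to `cos θ`. -/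
def tanDeriv (S : ℤ → R3) (n : ℤ) : ℝ := -((1 + spinCos S n) ^ 2 * tanF n S)⁻¹

/-- The radial part of the gradient of `γ_k` in the `k`-th spin. -/
def radialPart (S : ℤ → R3) (k : ℤ) : ℝ :=
  vdot (vcross (S (k - 1)) (S k)) (vcross (S k) (S (k + 1))) *
    vdot (S (k - 1)) (vcross (S k) (S (k + 1))) *
    ((1 - spinCos S (k - 1) ^ 2) * (1 - spinCos S k ^ 2))⁻¹

namespace RegularChain

variable {S : ℤ → R3} (hS : RegularChain S)

include hS

lemma vdot_pred_mem (k : ℤ) : vdot (S (k - 1)) (S k) ∈ Set.Ioo (-1 : ℝ) 1 := by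
  have := hS.dot_mem (k - 1)
  rwa [spinCos, sub_add_cancel] at this

lemma hasGradientAt_tanF_left (n : ℤ) :
    HasGradientAt (fun v => tanF n (Function.update S n v)) (tanDeriv S n • S (n + 1)) (S n) := by
  have : (fun v => tanF n (Function.update S n v))
      = fun v => Real.tan (Real.arccos (vdot v (S (n + 1))) / 2) := by
    funext v; simp [tanF, thetaF]
  rw [this]
  exact (hasGradientAt_vdot_right (S (n + 1)) (S n)).comp_deriv
    (hasDerivAt_tan_half_arccos (hS.dot_mem n))

lemma hasGradientAt_tanF_right (n : ℤ) :
    HasGradientAt (fun v => tanF n (Function.update S (n + 1) v)) (tanDeriv S n • S n)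
      (S (n + 1)) := by
  have : (fun v => tanF n (Function.update S (n + 1) v))
      = fun v => Real.tan (Real.arccos (vdot (S n) v) / 2) := by
    funext v; simp [tanF, thetaF]
  rw [this]
  exact (hasGradientAt_vdot (S n) (S (n + 1))).comp_deriv
    (hasDerivAt_tan_half_arccos (hS.dot_mem n))

omit hS in
lemma hasGradientAt_tanF_of_ne {n k : ℤ} (h₁ : k ≠ n) (h₂ : k ≠ n + 1) :
    HasGradientAt (fun v => tanF n (Function.update S k v)) 0 (S k) := by
  simp only [tanF_update_of_ne h₁ h₂]
  exact hasGradientAt_const _ _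

lemma hasGradientAt_tanF (n k : ℤ) :
    HasGradientAt (fun v => tanF n (Function.update S k v)) (gradTan S n k) (S k) := by
  refine DifferentiableAt.hasGradientAt ?_
  by_cases h₁ : k = n
  · subst h₁; exact (hS.hasGradientAt_tanF_left k).differentiableAt
  by_cases h₂ : k = n + 1
  · subst h₂; exact (hS.hasGradientAt_tanF_right n).differentiableAt
  exact (hasGradientAt_tanF_of_ne h₁ h₂).differentiableAt

lemma gradTan_left (n : ℤ) : gradTan S n n = tanDeriv S n • S (n + 1) :=
  (hS.hasGradientAt_tanF_left n).gradient

lemma gradTan_right (n : ℤ) : gradTan S n (n + 1) = tanDeriv S n • S n :=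
  (hS.hasGradientAt_tanF_right n).gradient

omit hS in
lemma gradTan_of_ne {n k : ℤ} (h₁ : k ≠ n) (h₂ : k ≠ n + 1) : gradTan S n k = 0 :=
  (hasGradientAt_tanF_of_ne h₁ h₂).gradient

lemma hasGradientAt_gammaF_left (k : ℤ) :
    HasGradientAt (fun v => gammaF (k + 1) (Function.update S k v))
      ((1 - spinCos S k ^ 2)⁻¹ • vcross (S k) (S (k + 1))) (S k) := by
  have : (fun v => gammaF (k + 1) (Function.update S k v))
      = fun v => turnAngle v (S (k + 1)) (S (k + 1 + 1)) := by
    funext v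
    rw [gammaF_eq_turnAngle, Function.update_of_ne (show k + 1 + 1 ≠ k by omega),
      Function.update_of_ne (show k + 1 ≠ k by omega), add_sub_cancel_right,
      Function.update_self]
  rw [this]
  have hγ := hS.gamma_mem (k + 1)
  rw [gammaF_eq_turnAngle, add_sub_cancel_right] at hγ
  exact hasGradientAt_turnAngle_left (hS.unit _) (hS.unit _) (hS.unit _) (hS.dot_mem k)
    (hS.dot_mem (k + 1)) hγ

lemma hasGradientAt_gammaF_right (k : ℤ) :
    HasGradientAt (fun v => gammaF (k - 1) (Function.update S k v))
      ((1 - spinCos S (k - 1) ^ 2)⁻¹ • vcross (S (k - 1)) (S k)) (S k) := by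
  have : (fun v => gammaF (k - 1) (Function.update S k v))
      = fun v => turnAngle (S (k - 1 - 1)) (S (k - 1)) v := by
    funext v
    rw [gammaF_eq_turnAngle, Function.update_of_ne (show k - 1 - 1 ≠ k by omega),
      Function.update_of_ne (show k - 1 ≠ k by omega), sub_add_cancel, Function.update_self]
  rw [this]
  have hγ := hS.gamma_mem (k - 1)
  rw [gammaF_eq_turnAngle, sub_add_cancel] at hγ
  rw [spinCos, sub_add_cancel]
  exact hasGradientAt_turnAngle_right (hS.unit _) (hS.unit _) (hS.unit _)
    (hS.vdot_pred_mem (k - 1)) (hS.vdot_pred_mem k) hγ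

lemma hasGradientAt_gammaF_mid (k : ℤ) :
    HasGradientAt (fun v => gammaF k (Function.update S k v))
      (-(spinCos S (k - 1) * (1 - spinCos S (k - 1) ^ 2)⁻¹) • vcross (S (k - 1)) (S k)
        - (spinCos S k * (1 - spinCos S k ^ 2)⁻¹) • vcross (S k) (S (k + 1))
        - radialPart S k • S k) (S k) := by
  have : (fun v => gammaF k (Function.update S k v))
      = fun v => turnAngle (S (k - 1)) v (S (k + 1)) := by
    funext v
    rw [gammaF_eq_turnAngle, Function.update_of_ne (show k - 1 ≠ k by omega),
      Function.update_of_ne (show k + 1 ≠ k by omega), Function.update_self]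
  rw [this, radialPart]
  simp only [spinCos, sub_add_cancel]
  exact hasGradientAt_turnAngle_mid (hS.unit _) (hS.unit _) (hS.unit _)
    (hS.vdot_pred_mem k) (hS.dot_mem k) (hS.gamma_mem k)

omit hS in
lemma hasGradientAt_gammaF_of_ne {n k : ℤ} (h₁ : n ≠ k - 1) (h₂ : n ≠ k) (h₃ : n ≠ k + 1) :
    HasGradientAt (fun v => gammaF n (Function.update S k v)) 0 (S k) := by
  simp only [gammaF_update_of_ne h₁ h₂ h₃]
  exact hasGradientAt_const _ _

lemma hasGradientAt_GammaF_of_pred {n k : ℤ} {X Y Z : R3}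
    (h₁ : HasGradientAt (fun v => GammaF (n - 1) (Function.update S k v)) X (S k))
    (h₂ : HasGradientAt (fun v => gammaF n (Function.update S k v)) Y (S k)) (h : X + Y = Z) :
    HasGradientAt (fun v => GammaF n (Function.update S k v)) Z (S k) := by
  simp only [fun v => (hS.summable.update k v).GammaF_eq n]
  exact (h₁.add' h₂).congr_gradient h

omit hS in
lemma hasGradientAt_GammaF_of_lt {n k : ℤ} (h : n < k - 1) :
    HasGradientAt (fun v => GammaF n (Function.update S k v)) 0 (S k) := by
  simp only [GammaF_update_of_lt h]
  exact hasGradientAt_const _ _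

lemma hasGradientAt_GammaF_pred (k : ℤ) :
    HasGradientAt (fun v => GammaF (k - 1) (Function.update S k v))
      ((1 - spinCos S (k - 1) ^ 2)⁻¹ • vcross (S (k - 1)) (S k)) (S k) :=
  hS.hasGradientAt_GammaF_of_pred (hasGradientAt_GammaF_of_lt (by omega))
    (hS.hasGradientAt_gammaF_right k) (zero_add _)

lemma hasGradientAt_GammaF_self (k : ℤ) :
    HasGradientAt (fun v => GammaF k (Function.update S k v))
      ((1 + spinCos S (k - 1))⁻¹ • vcross (S (k - 1)) (S k)
        - (spinCos S k * (1 - spinCos S k ^ 2)⁻¹) • vcross (S k) (S (k + 1))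
        - radialPart S k • S k) (S k) := by
  refine hS.hasGradientAt_GammaF_of_pred (hS.hasGradientAt_GammaF_pred k)
    (hS.hasGradientAt_gammaF_mid k) ?_
  have h1 := one_sub_sq_pos (hS.dot_mem (k - 1))
  have h2 : (0 : ℝ) < 1 + spinCos S (k - 1) := by linarith [(hS.dot_mem (k - 1)).1]
  have e : (1 + spinCos S (k - 1))⁻¹ = (1 - spinCos S (k - 1) ^ 2)⁻¹
      - spinCos S (k - 1) * (1 - spinCos S (k - 1) ^ 2)⁻¹ := by
    field_simp; ring
  rw [e]
  module

lemma hasGradientAt_GammaF_of_lt' {n k : ℤ} (h : k + 1 ≤ n) :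
    HasGradientAt (fun v => GammaF n (Function.update S k v))
      ((1 + spinCos S (k - 1))⁻¹ • vcross (S (k - 1)) (S k)
        + (1 + spinCos S k)⁻¹ • vcross (S k) (S (k + 1)) - radialPart S k • S k) (S k) := by
  induction n, h using Int.leInduction with
  | base =>
    have h0 := hS.hasGradientAt_GammaF_self k
    nth_rw 1 [← add_sub_cancel_right k 1] at h0
    refine hS.hasGradientAt_GammaF_of_pred h0 (hS.hasGradientAt_gammaF_left k) ?_
    have h1 := one_sub_sq_pos (hS.dot_mem k)
    have h2 : (0 : ℝ) < 1 + spinCos S k := by linarith [(hS.dot_mem k).1]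
    have e : (1 + spinCos S k)⁻¹ = (1 - spinCos S k ^ 2)⁻¹
        - spinCos S k * (1 - spinCos S k ^ 2)⁻¹ := by
      field_simp; ring
    rw [e]
    module
  | succ n hn ih =>
    nth_rw 1 [← add_sub_cancel_right n 1] at ih
    exact hS.hasGradientAt_GammaF_of_pred ih
      (hasGradientAt_gammaF_of_ne (by omega) (by omega) (by omega)) (add_zero _)

lemma hasGradientAt_GammaF (n k : ℤ) :
    HasGradientAt (fun v => GammaF n (Function.update S k v)) (gradGamma S n k) (S k) := by
  refine DifferentiableAt.hasGradientAt ?_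
  obtain h | rfl | rfl | h : n < k - 1 ∨ n = k - 1 ∨ n = k ∨ k + 1 ≤ n := by omega
  · exact (hasGradientAt_GammaF_of_lt h).differentiableAt
  · exact (hS.hasGradientAt_GammaF_pred k).differentiableAt
  · exact (hS.hasGradientAt_GammaF_self n).differentiableAt
  · exact (hS.hasGradientAt_GammaF_of_lt' h).differentiableAt

end RegularChain

/-! ### Triple products of tangent vectors -/

section TripleProduct

variable (a b c : R3) (x y z x' y' z' w w' : ℝ)

lemma triple_cross_cross :
    vdot b (vcross (x • vcross a b + y • vcross b c - z • b)
        (x' • vcross a b + y' • vcross b c - z' • b))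
      = vdot b b * (x * y' - y * x') * vdot a (vcross b c) := by
  simp only [vdot_eq, vcross_zero, vcross_one, vcross_two, PiLp.sub_apply, PiLp.smul_apply,
    PiLp.add_apply, smul_eq_mul]
  ring

lemma triple_cross_right :
    vdot b (vcross (x • vcross a b + y • vcross b c - z • b) (w • c))
      = -w * (x * vdot (vcross a b) (vcross b c) + y * (vdot b b * vdot c c - vdot b c ^ 2)) := by
  simp only [vdot_eq, vcross_zero, vcross_one, vcross_two, PiLp.sub_apply, PiLp.smul_apply,
    PiLp.add_apply, smul_eq_mul]
  ring

lemma triple_cross_left :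
    vdot b (vcross (x • vcross a b + y • vcross b c - z • b) (w • a))
      = w * (x * (vdot a a * vdot b b - vdot a b ^ 2) + y * vdot (vcross a b) (vcross b c)) := by
  simp only [vdot_eq, vcross_zero, vcross_one, vcross_two, PiLp.sub_apply, PiLp.smul_apply,
    PiLp.add_apply, smul_eq_mul]
  ring

lemma triple_right_left :
    vdot b (vcross (w • c) (w' • a)) = w * w' * vdot a (vcross b c) := by
  simp only [vdot_eq, vcross_zero, vcross_one, vcross_two, PiLp.smul_apply, smul_eq_mul]
  ring

end TripleProduct

lemma vdot_vcross_antisymm (b X Y : R3) : vdot b (vcross X Y) = -vdot b (vcross Y X) := by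
  simp only [vdot_eq, vcross_zero, vcross_one, vcross_two]; ring

lemma vdot_vcross_self (b X : R3) : vdot b (vcross X X) = 0 := by
  simp only [vdot_eq, vcross_zero, vcross_one, vcross_two]; ring

lemma vdot_vcross_zero_left (b X : R3) : vdot b (vcross 0 X) = 0 := by
  simp [vdot_eq, vcross_zero, vcross_one, vcross_two]

lemma vdot_vcross_zero_right (b X : R3) : vdot b (vcross X 0) = 0 := by
  simp [vdot_eq, vcross_zero, vcross_one, vcross_two]

lemma vdot_vcross_bilinear (b X Y X' Y' : R3) (p q p' q' : ℝ) :
    vdot b (vcross (p • X + q • Y) (p' • X' + q' • Y'))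
      = p * p' * vdot b (vcross X X') + p * q' * vdot b (vcross X Y')
        + q * p' * vdot b (vcross Y X') + q * q' * vdot b (vcross Y Y') := by
  simp only [vdot_eq, vcross_zero, vcross_one, vcross_two, PiLp.smul_apply, PiLp.add_apply,
    smul_eq_mul]
  ring

/-- The mixed product of the `k`-th spin with two vectors. -/
def spinTriple (S : ℤ → R3) (k : ℤ) (X Y : R3) : ℝ := vdot (S k) (vcross X Y)

namespace RegularChain

variable {S : ℤ → R3} (hS : RegularChain S)

include hS

lemma tanF_pos (n : ℤ) : 0 < tanF n S := tan_half_arccos_pos (hS.dot_mem n)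

lemma spinCos_eq (n : ℤ) : spinCos S n = (1 - tanF n S ^ 2) / (1 + tanF n S ^ 2) := by
  have h : tanF n S ^ 2 * (1 + spinCos S n) = 1 - spinCos S n :=
    tan_half_arccos_sq (hS.dot_mem n)
  have : 1 + tanF n S ^ 2 ≠ 0 := by positivity
  rw [eq_div_iff this]
  linarith

lemma one_add_spinCos_inv (n : ℤ) : (1 + spinCos S n)⁻¹ = (1 + tanF n S ^ 2) / 2 := by
  have : 1 + tanF n S ^ 2 ≠ 0 := by positivity
  rw [hS.spinCos_eq, inv_eq_iff_eq_inv]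
  field_simp
  ring

lemma one_sub_spinCos_sq (n : ℤ) :
    1 - spinCos S n ^ 2 = (2 * tanF n S / (1 + tanF n S ^ 2)) ^ 2 := by
  have : 1 + tanF n S ^ 2 ≠ 0 := by positivity
  rw [hS.spinCos_eq]
  field_simp
  ring

lemma tanDeriv_eq (n : ℤ) : tanDeriv S n = -((1 + tanF n S ^ 2) ^ 2 / (4 * tanF n S)) := by
  have := (hS.tanF_pos n).ne'
  rw [tanDeriv, mul_inv, ← inv_pow, hS.one_add_spinCos_inv]
  field_simp
  norm_num

lemma gradGamma_of_lt {n k : ℤ} (h : k + 1 ≤ n) :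
    gradGamma S n k = ((1 + tanF (k - 1) S ^ 2) / 2) • vcross (S (k - 1)) (S k)
        + ((1 + tanF k S ^ 2) / 2) • vcross (S k) (S (k + 1)) - radialPart S k • S k := by
  rw [← hS.one_add_spinCos_inv, ← hS.one_add_spinCos_inv]
  exact (hS.hasGradientAt_GammaF_of_lt' h).gradient

lemma gradGamma_self (k : ℤ) :
    gradGamma S k k = ((1 + tanF (k - 1) S ^ 2) / 2) • vcross (S (k - 1)) (S k)
        + (-((1 - tanF k S ^ 4) / (4 * tanF k S ^ 2))) • vcross (S k) (S (k + 1))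
        - radialPart S k • S k := by
  have e : spinCos S k * (1 - spinCos S k ^ 2)⁻¹ = (1 - tanF k S ^ 4) / (4 * tanF k S ^ 2) := by
    have := (hS.tanF_pos k).ne'
    have : 1 + tanF k S ^ 2 ≠ 0 := by positivity
    rw [hS.one_sub_spinCos_sq, hS.spinCos_eq]
    field_simp
    ring
  rw [← hS.one_add_spinCos_inv, ← e, neg_smul, ← sub_eq_add_neg]
  exact (hS.hasGradientAt_GammaF_self k).gradient

lemma gradGamma_pred (k : ℤ) :
    gradGamma S (k - 1) k
      = ((1 + tanF (k - 1) S ^ 2) ^ 2 / (4 * tanF (k - 1) S ^ 2)) • vcross (S (k - 1)) (S k)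
        + (0 : ℝ) • vcross (S k) (S (k + 1)) - (0 : ℝ) • S k := by
  have e : (1 - spinCos S (k - 1) ^ 2)⁻¹
      = (1 + tanF (k - 1) S ^ 2) ^ 2 / (4 * tanF (k - 1) S ^ 2) := by
    rw [hS.one_sub_spinCos_sq, ← inv_pow, inv_div, div_pow]
    ring
  rw [← e, zero_smul, zero_smul, add_zero, sub_zero]
  exact (hS.hasGradientAt_GammaF_pred k).gradient

omit hS in
lemma gradGamma_of_gt {n k : ℤ} (h : n < k - 1) : gradGamma S n k = 0 :=
  (hasGradientAt_GammaF_of_lt h).gradient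

lemma gradTan_pred (k : ℤ) : gradTan S (k - 1) k = tanDeriv S (k - 1) • S (k - 1) := by
  have := hS.gradTan_right (k - 1)
  rwa [sub_add_cancel] at this

lemma sqrt_sines (k : ℤ) :
    √((1 - vdot (S (k - 1)) (S k) ^ 2) * (1 - vdot (S k) (S (k + 1)) ^ 2))
      = 2 * tanF (k - 1) S / (1 + tanF (k - 1) S ^ 2) * (2 * tanF k S / (1 + tanF k S ^ 2)) := by
  have h1 := hS.one_sub_spinCos_sq (k - 1)
  have h2 := hS.one_sub_spinCos_sq k
  rw [spinCos, sub_add_cancel] at h1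
  rw [spinCos] at h2
  have := hS.tanF_pos k
  have := hS.tanF_pos (k - 1)
  rw [h1, h2, ← mul_pow, Real.sqrt_sq (by positivity)]

lemma dot_cross_cross (k : ℤ) :
    vdot (vcross (S (k - 1)) (S k)) (vcross (S k) (S (k + 1)))
      = 2 * tanF (k - 1) S / (1 + tanF (k - 1) S ^ 2) * (2 * tanF k S / (1 + tanF k S ^ 2))
        * Real.cos (gammaF k S) := by
  rw [← hS.sqrt_sines, gammaF_eq_turnAngle]
  exact vdot_vcross_vcross_eq_cos (hS.unit _) (hS.unit _) (hS.unit _)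

lemma dot_cross (k : ℤ) :
    vdot (S (k - 1)) (vcross (S k) (S (k + 1)))
      = 2 * tanF (k - 1) S / (1 + tanF (k - 1) S ^ 2) * (2 * tanF k S / (1 + tanF k S ^ 2))
        * Real.sin (gammaF k S) := by
  rw [← hS.sqrt_sines, gammaF_eq_turnAngle]
  exact vdot_vcross_eq_sin (hS.unit _) (hS.unit _) (hS.unit _)

/-! ### Mixed products of the gradients at a single site -/

lemma spinTriple_cross_cross (k : ℤ) (x y z x' y' z' : ℝ) :
    spinTriple S k (x • vcross (S (k - 1)) (S k) + y • vcross (S k) (S (k + 1)) - z • S k)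
        (x' • vcross (S (k - 1)) (S k) + y' • vcross (S k) (S (k + 1)) - z' • S k)
      = (x * y' - y * x') * (2 * tanF (k - 1) S / (1 + tanF (k - 1) S ^ 2)
        * (2 * tanF k S / (1 + tanF k S ^ 2)) * Real.sin (gammaF k S)) := by
  rw [spinTriple, triple_cross_cross, hS.unit, hS.dot_cross, one_mul]

lemma spinTriple_cross_right (k : ℤ) (x y z w : ℝ) :
    spinTriple S k (x • vcross (S (k - 1)) (S k) + y • vcross (S k) (S (k + 1)) - z • S k)
        (w • S (k + 1))
      = -w * (x * (2 * tanF (k - 1) S / (1 + tanF (k - 1) S ^ 2)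
          * (2 * tanF k S / (1 + tanF k S ^ 2)) * Real.cos (gammaF k S))
        + y * (2 * tanF k S / (1 + tanF k S ^ 2)) ^ 2) := by
  have h := hS.one_sub_spinCos_sq k
  rw [spinCos] at h
  rw [spinTriple, triple_cross_right, hS.unit, hS.unit, hS.dot_cross_cross, one_mul, h]

lemma spinTriple_cross_left (k : ℤ) (x y z w : ℝ) :
    spinTriple S k (x • vcross (S (k - 1)) (S k) + y • vcross (S k) (S (k + 1)) - z • S k)
        (w • S (k - 1))
      = w * (x * (2 * tanF (k - 1) S / (1 + tanF (k - 1) S ^ 2)) ^ 2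
        + y * (2 * tanF (k - 1) S / (1 + tanF (k - 1) S ^ 2)
          * (2 * tanF k S / (1 + tanF k S ^ 2)) * Real.cos (gammaF k S))) := by
  have h := hS.one_sub_spinCos_sq (k - 1)
  rw [spinCos, sub_add_cancel] at h
  rw [spinTriple, triple_cross_left, hS.unit, hS.unit, hS.dot_cross_cross, one_mul, h]

lemma spinTriple_right_left (k : ℤ) (w w' : ℝ) :
    spinTriple S k (w • S (k + 1)) (w' • S (k - 1))
      = w * w' * (2 * tanF (k - 1) S / (1 + tanF (k - 1) S ^ 2)
        * (2 * tanF k S / (1 + tanF k S ^ 2)) * Real.sin (gammaF k S)) := by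
  rw [spinTriple, triple_right_left, hS.dot_cross]

end RegularChain

lemma pbTerm_antisymm (F G : (ℤ → R3) → ℝ) (S : ℤ → R3) (k : ℤ) :
    pbTerm F G S k = -pbTerm G F S k := vdot_vcross_antisymm _ _ _

lemma pb_antisymm (F G : (ℤ → R3) → ℝ) (S : ℤ → R3) : pb F G S = -pb G F S := by
  rw [pb, pb, tsum_congr (pbTerm_antisymm F G S), tsum_neg]

/-- `F` is a function of `(tan (θ_n / 2), Γ(n))` with partial derivatives `p` and `q`. -/
def IsPolar (S : ℤ → R3) (F : (ℤ → R3) → ℝ) (n : ℤ) (p q : ℝ) : Prop :=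
  ∀ k, HasGradientAt (fun v => F (Function.update S k v))
    (p • gradTan S n k + q • gradGamma S n k) (S k)

lemma alphaF_re (n : ℤ) (S : ℤ → R3) :
    (alphaF n S).re = tanF n S * Real.cos (GammaF n S) := by
  have : -Complex.I * ((GammaF n S : ℝ) : ℂ) = ((-GammaF n S : ℝ) : ℂ) * Complex.I := by
    push_cast; ring
  rw [alphaF, this, Complex.re_ofReal_mul, Complex.exp_ofReal_mul_I_re, Real.cos_neg, tanF]

lemma alphaF_im (n : ℤ) (S : ℤ → R3) :
    (alphaF n S).im = tanF n S * -Real.sin (GammaF n S) := by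
  have : -Complex.I * ((GammaF n S : ℝ) : ℂ) = ((-GammaF n S : ℝ) : ℂ) * Complex.I := by
    push_cast; ring
  rw [alphaF, this, Complex.im_ofReal_mul, Complex.exp_ofReal_mul_I_im, Real.sin_neg, tanF]

lemma normSq_alphaF (n : ℤ) (S : ℤ → R3) : Complex.normSq (alphaF n S) = tanF n S ^ 2 := by
  rw [Complex.normSq_apply, alphaF_re, alphaF_im]
  linear_combination tanF n S ^ 2 * Real.sin_sq_add_cos_sq (GammaF n S)

namespace RegularChain

variable {S : ℤ → R3} (hS : RegularChain S)

include hS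

lemma isPolar_reA (n : ℤ) :
    IsPolar S (reA n) n (Real.cos (GammaF n S)) (tanF n S * -Real.sin (GammaF n S)) := by
  intro k
  simp only [reA, alphaF_re]
  have h := (hS.hasGradientAt_tanF n k).mul'
    ((hS.hasGradientAt_GammaF n k).comp_deriv (Real.hasDerivAt_cos _))
  rw [Function.update_eq_self] at h
  refine h.congr_gradient ?_
  module

lemma isPolar_imA (n : ℤ) :
    IsPolar S (imA n) n (-Real.sin (GammaF n S)) (tanF n S * -Real.cos (GammaF n S)) := by
  intro k
  simp only [imA, alphaF_im]
  have h := (hS.hasGradientAt_tanF n k).mul'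
    ((hS.hasGradientAt_GammaF n k).comp_deriv (Real.hasDerivAt_sin _).neg)
  rw [Function.update_eq_self] at h
  refine h.congr_gradient ?_
  simp only [Pi.neg_apply]
  module

lemma pbTerm_of_isPolar {F G : (ℤ → R3) → ℝ} {n m : ℤ} {p q p' q' : ℝ}
    (hF : IsPolar S F n p q) (hG : IsPolar S G m p' q') (k : ℤ) :
    pbTerm F G S k = p * p' * spinTriple S k (gradTan S n k) (gradTan S m k)
      + p * q' * spinTriple S k (gradTan S n k) (gradGamma S m k)
      + q * p' * spinTriple S k (gradGamma S n k) (gradTan S m k)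
      + q * q' * spinTriple S k (gradGamma S n k) (gradGamma S m k) := by
  rw [pbTerm_eq_of_hasGradientAt (hS.unit k) (hF k) (hG k), vdot_vcross_bilinear]
  rfl

lemma pbTerm_eq_zero {F G : (ℤ → R3) → ℝ} {n m : ℤ} {p q p' q' : ℝ}
    (hF : IsPolar S F n p q) (hG : IsPolar S G m p' q') (hmn : m ≤ n) {k : ℤ}
    (h₁ : k ≠ m) (h₂ : k ≠ m + 1) : pbTerm F G S k = 0 := by
  rw [hS.pbTerm_of_isPolar hF hG, gradTan_of_ne h₁ h₂]
  obtain h | h : m < k - 1 ∨ k + 1 ≤ m := by omega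
  · simp [spinTriple, gradGamma_of_gt h, vdot_vcross_zero_right]
  · rw [gradTan_of_ne (n := n) (by omega) (by omega), hS.gradGamma_of_lt h,
      hS.gradGamma_of_lt (h.trans hmn)]
    simp [spinTriple, vdot_vcross_zero_right, vdot_vcross_zero_left, vdot_vcross_self]

lemma pb_of_isPolar {F G : (ℤ → R3) → ℝ} {n m : ℤ} {p q p' q' : ℝ}
    (hF : IsPolar S F n p q) (hG : IsPolar S G m p' q') (hmn : m ≤ n) :
    pb F G S = -(pbTerm F G S m + pbTerm F G S (m + 1)) := by
  rw [pb, tsum_eq_sum (s := {m, m + 1}), Finset.sum_pair (by omega)]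
  intro k hk
  simp only [Finset.mem_insert, Finset.mem_singleton, not_or] at hk
  exact hS.pbTerm_eq_zero hF hG hmn hk.1 hk.2

lemma finite_support_pbTerm {F G : (ℤ → R3) → ℝ} {n m : ℤ} {p q p' q' : ℝ}
    (hF : IsPolar S F n p q) (hG : IsPolar S G m p' q') :
    {k : ℤ | pbTerm F G S k ≠ 0}.Finite := by
  wlog hmn : m ≤ n generalizing F G n m p q p' q'
  · have := this hG hF (by omega)
    simp only [pbTerm_antisymm F G, neg_ne_zero]
    exact this
  · refine (Set.toFinite {m, m + 1}).subset fun k hk => ?_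
    by_contra h
    simp only [Set.mem_insert_iff, Set.mem_singleton_iff, not_or] at h
    exact hk (hS.pbTerm_eq_zero hF hG hmn h.1 h.2)

lemma pbTerm_left_of_isPolar {F G : (ℤ → R3) → ℝ} {n m : ℤ} {p q p' q' : ℝ}
    (hF : IsPolar S F n p q) (hG : IsPolar S G m p' q') (hmn : m + 1 ≤ n) :
    pbTerm F G S m
      = q * p' * ((1 + tanF m S ^ 2) / 2
          * (tanF (m - 1) S * Real.cos (gammaF m S) + tanF m S))
        - q * q' * ((1 + tanF m S ^ 2) / (2 * tanF m S) * tanF (m - 1) S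
          * Real.sin (gammaF m S)) := by
  have h0 := (hS.tanF_pos m).ne'
  have h1 : 1 + tanF m S ^ 2 ≠ 0 := by positivity
  have h2 : 1 + tanF (m - 1) S ^ 2 ≠ 0 := by positivity
  rw [hS.pbTerm_of_isPolar hF hG, gradTan_of_ne (n := n) (by omega) (by omega), hS.gradTan_left,
    hS.gradGamma_of_lt hmn, hS.gradGamma_self, hS.spinTriple_cross_cross,
    hS.spinTriple_cross_right, hS.tanDeriv_eq, spinTriple, spinTriple, vdot_vcross_zero_left,
    vdot_vcross_zero_left]
  field_simp
  ring

lemma pbTerm_right_of_isPolar {F G : (ℤ → R3) → ℝ} {n m : ℤ} {p q p' q' : ℝ}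
    (hF : IsPolar S F n p q) (hG : IsPolar S G m p' q') (hmn : m + 2 ≤ n) :
    pbTerm F G S (m + 1)
      = -(q * p' * ((1 + tanF m S ^ 2) / 2
          * (tanF (m + 1) S * Real.cos (gammaF (m + 1) S) + tanF m S)))
        - q * q' * ((1 + tanF m S ^ 2) / (2 * tanF m S) * tanF (m + 1) S
          * Real.sin (gammaF (m + 1) S)) := by
  obtain ⟨k, rfl⟩ : ∃ k, m = k - 1 := ⟨m + 1, by ring⟩
  rw [sub_add_cancel]
  have h0 := (hS.tanF_pos (k - 1)).ne'
  have h1 : 1 + tanF k S ^ 2 ≠ 0 := by positivity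
  have h2 : 1 + tanF (k - 1) S ^ 2 ≠ 0 := by positivity
  rw [hS.pbTerm_of_isPolar hF hG, gradTan_of_ne (n := n) (by omega) (by omega), hS.gradTan_pred,
    hS.gradGamma_of_lt (n := n) (by omega), hS.gradGamma_pred, hS.spinTriple_cross_cross,
    hS.spinTriple_cross_left, hS.tanDeriv_eq, spinTriple, spinTriple, vdot_vcross_zero_left,
    vdot_vcross_zero_left]
  field_simp
  ring

lemma pbTerm_right_of_isPolar_succ {F G : (ℤ → R3) → ℝ} {m : ℤ} {p q p' q' : ℝ}
    (hF : IsPolar S F (m + 1) p q) (hG : IsPolar S G m p' q') :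
    pbTerm F G S (m + 1)
      = -(q * p' * ((1 + tanF m S ^ 2) / 2
          * (tanF (m + 1) S * Real.cos (gammaF (m + 1) S) + tanF m S)))
        - q * q' * ((1 + tanF m S ^ 2) / (2 * tanF m S) * tanF (m + 1) S
          * Real.sin (gammaF (m + 1) S))
        + (1 + tanF m S ^ 2) / 2 * ((1 + tanF (m + 1) S ^ 2) / 2)
          * (p * p' * Real.sin (gammaF (m + 1) S)
            - p * (q' / tanF m S) * Real.cos (gammaF (m + 1) S)
            + q / tanF (m + 1) S * p' * Real.cos (gammaF (m + 1) S)
            + q / tanF (m + 1) S * (q' / tanF m S) * Real.sin (gammaF (m + 1) S)) := by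
  obtain ⟨k, rfl⟩ : ∃ k, m = k - 1 := ⟨m + 1, by ring⟩
  rw [sub_add_cancel] at hF ⊢
  have h0 := (hS.tanF_pos (k - 1)).ne'
  have h0' := (hS.tanF_pos k).ne'
  have h1 : 1 + tanF k S ^ 2 ≠ 0 := by positivity
  have h2 : 1 + tanF (k - 1) S ^ 2 ≠ 0 := by positivity
  have h3 (X Y : R3) : spinTriple S k X Y = -spinTriple S k Y X := vdot_vcross_antisymm _ _ _
  rw [hS.pbTerm_of_isPolar hF hG, hS.gradTan_left, hS.gradTan_pred, hS.gradGamma_self,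
    hS.gradGamma_pred, hS.spinTriple_right_left, h3 (tanDeriv S k • S (k + 1)),
    hS.spinTriple_cross_right, hS.spinTriple_cross_cross, hS.spinTriple_cross_left,
    hS.tanDeriv_eq, hS.tanDeriv_eq]
  field_simp
  ring

/-- The bracket of functions of `(tan (θ_n / 2), Γ(n))` and `(tan (θ_m / 2), Γ(m))`, `n ≥ m + 2`. -/
lemma pb_of_isPolar_of_lt {F G : (ℤ → R3) → ℝ} {n m : ℤ} {p q p' q' : ℝ}
    (hF : IsPolar S F n p q) (hG : IsPolar S G m p' (tanF m S * q')) (hmn : m + 2 ≤ n) :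
    pb F G S = -((1 + tanF m S ^ 2) / 2) * q
      * (tanF (m - 1) S * (p' * Real.cos (gammaF m S) - q' * Real.sin (gammaF m S))
        - tanF (m + 1) S * (p' * Real.cos (gammaF (m + 1) S)
          + q' * Real.sin (gammaF (m + 1) S))) := by
  have h0 := (hS.tanF_pos m).ne'
  rw [hS.pb_of_isPolar hF hG (by omega), hS.pbTerm_left_of_isPolar hF hG (by omega),
    hS.pbTerm_right_of_isPolar hF hG hmn]
  field_simp
  ring

/-- The bracket of functions of `(tan (θ_n / 2), Γ(n))` and `(tan (θ_m / 2), Γ(m))`, `n = m + 1`. -/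
lemma pb_of_isPolar_succ {F G : (ℤ → R3) → ℝ} {m : ℤ} {p q p' q' : ℝ}
    (hF : IsPolar S F (m + 1) p (tanF (m + 1) S * q)) (hG : IsPolar S G m p' (tanF m S * q')) :
    pb F G S = -((1 + tanF m S ^ 2) / 2) * (tanF (m + 1) S * q
      * (tanF (m - 1) S * (p' * Real.cos (gammaF m S) - q' * Real.sin (gammaF m S))
        - tanF (m + 1) S * (p' * Real.cos (gammaF (m + 1) S)
          + q' * Real.sin (gammaF (m + 1) S)))
      + (1 + tanF (m + 1) S ^ 2) / 2 * ((p * p' + q * q') * Real.sin (gammaF (m + 1) S)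
          - (p * q' - q * p') * Real.cos (gammaF (m + 1) S))) := by
  have h0 := (hS.tanF_pos m).ne'
  have h1 := (hS.tanF_pos (m + 1)).ne'
  rw [hS.pb_of_isPolar hF hG (by omega), hS.pbTerm_left_of_isPolar hF hG le_rfl,
    hS.pbTerm_right_of_isPolar_succ hF hG]
  field_simp
  ring

/-- The bracket of two functions of `(tan (θ_n / 2), Γ(n))`. -/
lemma pb_of_isPolar_self {F G : (ℤ → R3) → ℝ} {n : ℤ} {p q p' q' : ℝ}
    (hF : IsPolar S F n p (tanF n S * q)) (hG : IsPolar S G n p' (tanF n S * q')) :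
    pb F G S = (p * q' - q * p') * (-((1 + tanF n S ^ 2) / 2)
      * (1 - tanF (n - 1) S * tanF n S * Real.cos (gammaF n S))) := by
  have h0 := (hS.tanF_pos n).ne'
  have h1 : 1 + tanF n S ^ 2 ≠ 0 := by positivity
  have h2 : 1 + tanF (n - 1) S ^ 2 ≠ 0 := by positivity
  have h3 (k : ℤ) (X Y : R3) : spinTriple S k X Y = -spinTriple S k Y X :=
    vdot_vcross_antisymm _ _ _
  have h4 (k : ℤ) (X : R3) : spinTriple S k X X = 0 := vdot_vcross_self _ _
  have h5 : spinTriple S n (gradGamma S n n) (gradTan S n n) = (1 + tanF n S ^ 2) / 2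
      * (tanF (n - 1) S * Real.cos (gammaF n S)) - (1 - tanF n S ^ 4) / (4 * tanF n S) := by
    rw [hS.gradTan_left, hS.gradGamma_self, hS.spinTriple_cross_right, hS.tanDeriv_eq]
    field_simp
    ring
  have h6 : spinTriple S (n + 1) (gradGamma S n (n + 1)) (gradTan S n (n + 1))
      = -((1 + tanF n S ^ 2) ^ 2 / (4 * tanF n S)) := by
    obtain ⟨k, rfl⟩ : ∃ k, n = k - 1 := ⟨n + 1, by ring⟩
    rw [sub_add_cancel, hS.gradTan_pred, hS.gradGamma_pred, hS.spinTriple_cross_left,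
      hS.tanDeriv_eq]
    field_simp
    ring
  rw [hS.pb_of_isPolar hF hG le_rfl, hS.pbTerm_of_isPolar hF hG, hS.pbTerm_of_isPolar hF hG,
    h3 n (gradTan S n n) (gradGamma S n n), h3 (n + 1) (gradTan S n _) (gradGamma S n _)]
  simp only [h4]
  rw [h5, h6]
  field_simp
  ring

lemma alphaF_pred_re (m : ℤ) : (alphaF (m - 1) S).re
    = tanF (m - 1) S * (Real.cos (GammaF m S) * Real.cos (gammaF m S)
      + Real.sin (GammaF m S) * Real.sin (gammaF m S)) := by
  rw [alphaF_re, ← Real.cos_sub, hS.summable.GammaF_eq m, add_sub_cancel_right]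

lemma alphaF_pred_im (m : ℤ) : (alphaF (m - 1) S).im
    = tanF (m - 1) S * -(Real.sin (GammaF m S) * Real.cos (gammaF m S)
      - Real.cos (GammaF m S) * Real.sin (gammaF m S)) := by
  rw [alphaF_im, ← Real.sin_sub, hS.summable.GammaF_eq m, add_sub_cancel_right]

lemma GammaF_succ (m : ℤ) : GammaF (m + 1) S = GammaF m S + gammaF (m + 1) S := by
  rw [hS.summable.GammaF_eq (m + 1), add_sub_cancel_right]

lemma pb_reA_imA_of_lt {n m : ℤ} (h : m + 2 ≤ n) :
    pb (reA n) (imA m) S = -((1 + Complex.normSq (alphaF m S)) / 2) * (alphaF n S).im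
      * (alphaF (m - 1) S - alphaF (m + 1) S).im := by
  rw [hS.pb_of_isPolar_of_lt (hS.isPolar_reA n) (hS.isPolar_imA m) h, Complex.sub_im,
    hS.alphaF_pred_im, normSq_alphaF, alphaF_im, alphaF_im, hS.GammaF_succ, Real.sin_add]
  ring

lemma pb_imA_reA_of_lt {n m : ℤ} (h : m + 2 ≤ n) :
    pb (imA n) (reA m) S = (1 + Complex.normSq (alphaF m S)) / 2 * (alphaF n S).re
      * (alphaF (m - 1) S - alphaF (m + 1) S).re := by
  rw [hS.pb_of_isPolar_of_lt (hS.isPolar_imA n) (hS.isPolar_reA m) h, Complex.sub_re,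
    hS.alphaF_pred_re, normSq_alphaF, alphaF_re, alphaF_re, hS.GammaF_succ, Real.cos_add]
  ring

lemma pb_reA_imA_succ (m : ℤ) :
    pb (reA (m + 1)) (imA m) S = -((1 + Complex.normSq (alphaF m S)) / 2)
      * ((alphaF (m + 1) S).im * (alphaF (m - 1) S - alphaF (m + 1) S).im
        + (1 + Complex.normSq (alphaF (m + 1) S)) / 2) := by
  rw [hS.pb_of_isPolar_succ (hS.isPolar_reA (m + 1)) (hS.isPolar_imA m), Complex.sub_im,
    hS.alphaF_pred_im, normSq_alphaF, normSq_alphaF, alphaF_im, hS.GammaF_succ, Real.sin_add,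
    Real.cos_add]
  linear_combination -((1 + tanF m S ^ 2) / 2) * ((1 + tanF (m + 1) S ^ 2) / 2)
    * (Real.sin_sq_add_cos_sq (GammaF m S)
      + (Real.sin (GammaF m S) ^ 2 + Real.cos (GammaF m S) ^ 2)
        * Real.sin_sq_add_cos_sq (gammaF (m + 1) S))

lemma pb_imA_reA_succ (m : ℤ) :
    pb (imA (m + 1)) (reA m) S = (1 + Complex.normSq (alphaF m S)) / 2
      * ((alphaF (m + 1) S).re * (alphaF (m - 1) S - alphaF (m + 1) S).re
        + (1 + Complex.normSq (alphaF (m + 1) S)) / 2) := by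
  rw [hS.pb_of_isPolar_succ (hS.isPolar_imA (m + 1)) (hS.isPolar_reA m), Complex.sub_re,
    hS.alphaF_pred_re, normSq_alphaF, normSq_alphaF, alphaF_re, hS.GammaF_succ, Real.sin_add,
    Real.cos_add]
  linear_combination ((1 + tanF m S ^ 2) / 2) * ((1 + tanF (m + 1) S ^ 2) / 2)
    * (Real.sin_sq_add_cos_sq (GammaF m S)
      + (Real.sin (GammaF m S) ^ 2 + Real.cos (GammaF m S) ^ 2)
        * Real.sin_sq_add_cos_sq (gammaF (m + 1) S))

lemma pb_reA_reA {n m : ℤ} (h : m + 1 ≤ n) :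
    pb (reA n) (reA m) S = -((1 + Complex.normSq (alphaF m S)) / 2) * (alphaF n S).im
      * (alphaF (m - 1) S - alphaF (m + 1) S).re := by
  obtain rfl | h := h.eq_or_lt
  · rw [hS.pb_of_isPolar_succ (hS.isPolar_reA (m + 1)) (hS.isPolar_reA m), Complex.sub_re,
      hS.alphaF_pred_re, normSq_alphaF, alphaF_im, alphaF_re, hS.GammaF_succ, Real.sin_add,
      Real.cos_add]
    ring
  · rw [hS.pb_of_isPolar_of_lt (hS.isPolar_reA n) (hS.isPolar_reA m) (by omega), Complex.sub_re,
      hS.alphaF_pred_re, normSq_alphaF, alphaF_im, alphaF_re, hS.GammaF_succ, Real.cos_add]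
    ring

lemma pb_imA_imA {n m : ℤ} (h : m + 1 ≤ n) :
    pb (imA n) (imA m) S = (1 + Complex.normSq (alphaF m S)) / 2 * (alphaF n S).re
      * (alphaF (m - 1) S - alphaF (m + 1) S).im := by
  obtain rfl | h := h.eq_or_lt
  · rw [hS.pb_of_isPolar_succ (hS.isPolar_imA (m + 1)) (hS.isPolar_imA m), Complex.sub_im,
      hS.alphaF_pred_im, normSq_alphaF, alphaF_im, alphaF_re, hS.GammaF_succ, Real.sin_add,
      Real.cos_add]
    ring
  · rw [hS.pb_of_isPolar_of_lt (hS.isPolar_imA n) (hS.isPolar_imA m) (by omega), Complex.sub_im,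
      hS.alphaF_pred_im, normSq_alphaF, alphaF_im, alphaF_re, hS.GammaF_succ, Real.sin_add]
    ring

lemma pb_reA_imA_self (n : ℤ) :
    pb (reA n) (imA n) S = (1 + Complex.normSq (alphaF n S)) / 2
      * (1 - (alphaF n S * (starRingEnd ℂ) (alphaF (n - 1) S)).re) := by
  rw [hS.pb_of_isPolar_self (hS.isPolar_reA n) (hS.isPolar_imA n), Complex.mul_re,
    Complex.conj_re, Complex.conj_im, hS.alphaF_pred_re, hS.alphaF_pred_im, normSq_alphaF,
    alphaF_re, alphaF_im]
  linear_combination ((1 + tanF n S ^ 2) / 2) * Real.sin_sq_add_cos_sq (GammaF n S)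

end RegularChain

lemma pb_self (F : (ℤ → R3) → ℝ) (S : ℤ → R3) : pb F F S = 0 := by
  linarith [pb_antisymm F F S]

/-- the Poisson brackets among the functions {Re α_n, Im α_n : n ∈ ℤ}. -/
theorem poisson_brackets_alpha
    (S : ℤ → R3)
    (hunit : ∀ n : ℤ, vdot (S n) (S n) = 1)
    (hdot : ∀ n : ℤ, vdot (S n) (S (n+1)) ∈ Set.Ioo (-1 : ℝ) 1)
    (hγ : ∀ n : ℤ, gammaF n S ∈ Set.Ioo (-Real.pi) Real.pi)
    (hsum : ∀ n : ℤ, Summable (fun ℓ : {ℓ : ℤ // ℓ ≤ n} => |gammaF ℓ.val S|)) :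
    -- all but finitely many summands in each bracket vanish:
    (∀ F G : (ℤ → R3) → ℝ, (∃ n : ℤ, F = reA n ∨ F = imA n) → (∃ m : ℤ, G = reA m ∨ G = imA m) →
      {k : ℤ | pbTerm F G S k ≠ 0}.Finite)
    -- {Re α_n, Im α_m}:
    ∧ (∀ n m : ℤ, m + 2 ≤ n → pb (reA n) (imA m) S
        = -((1 + Complex.normSq (alphaF m S))/2) * (alphaF n S).im
            * (alphaF (m-1) S - alphaF (m+1) S).im)
    ∧ (∀ n m : ℤ, n = m + 1 → pb (reA n) (imA m) S
        = -((1 + Complex.normSq (alphaF m S))/2) * ((alphaF n S).im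
            * (alphaF (m-1) S - alphaF (m+1) S).im + (1 + Complex.normSq (alphaF n S))/2))
    ∧ (∀ n : ℤ, pb (reA n) (imA n) S
        = ((1 + Complex.normSq (alphaF n S))/2)
            * (1 - (alphaF n S * (starRingEnd ℂ) (alphaF (n-1) S)).re))
    ∧ (∀ n m : ℤ, n = m - 1 → pb (reA n) (imA m) S
        = -((1 + Complex.normSq (alphaF n S))/2) * ((alphaF m S).re
            * (alphaF (n-1) S - alphaF (n+1) S).re + (1 + Complex.normSq (alphaF m S))/2))
    ∧ (∀ n m : ℤ, n ≤ m - 2 → pb (reA n) (imA m) S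
        = -((1 + Complex.normSq (alphaF n S))/2) * (alphaF m S).re
            * (alphaF (n-1) S - alphaF (n+1) S).re)
    -- {Re α_n, Re α_m} and {Im α_n, Im α_m} for n ≥ m+1:
    ∧ (∀ n m : ℤ, m + 1 ≤ n → pb (reA n) (reA m) S
        = -((1 + Complex.normSq (alphaF m S))/2) * (alphaF n S).im
            * (alphaF (m-1) S - alphaF (m+1) S).re)
    ∧ (∀ n m : ℤ, m + 1 ≤ n → pb (imA n) (imA m) S
        = ((1 + Complex.normSq (alphaF m S))/2) * (alphaF n S).re
            * (alphaF (m-1) S - alphaF (m+1) S).im)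
    -- the diagonal brackets determined by antisymmetry:
    ∧ (∀ n : ℤ, pb (reA n) (reA n) S = 0)
    ∧ (∀ n : ℤ, pb (imA n) (imA n) S = 0) := by
  have hS : RegularChain S := ⟨hunit, hdot, hγ, fun n => (hsum n).of_abs⟩
  refine ⟨?_, fun n m h => hS.pb_reA_imA_of_lt h, ?_, hS.pb_reA_imA_self, ?_, ?_,
    fun n m h => hS.pb_reA_reA h, fun n m h => hS.pb_imA_imA h, fun n => pb_self _ S,
    fun n => pb_self _ S⟩
  · rintro F G ⟨n, rfl | rfl⟩ ⟨m, rfl | rfl⟩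
    exacts [hS.finite_support_pbTerm (hS.isPolar_reA n) (hS.isPolar_reA m),
      hS.finite_support_pbTerm (hS.isPolar_reA n) (hS.isPolar_imA m),
      hS.finite_support_pbTerm (hS.isPolar_imA n) (hS.isPolar_reA m),
      hS.finite_support_pbTerm (hS.isPolar_imA n) (hS.isPolar_imA m)]
  · rintro n m rfl
    exact hS.pb_reA_imA_succ m
  · rintro n m h
    obtain rfl : m = n + 1 := by omega
    rw [pb_antisymm, hS.pb_imA_reA_succ]
    ring
  · intro n m h
    rw [pb_antisymm, hS.pb_imA_reA_of_lt (by omega)]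
    ring
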